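/- arXiv:1510.03917 — 2 statements merged into one kernel-verified Lean document; each statement's English description precedes it below -/
import Mathlib

section
/- For every integer q ≥ 2, the sequence II_n(Z_2, q) converges to a limit I(Z_2, q) satisfying 1/q < I(Z_2, q) < 1/(q−1). -/
/-- A word is a `Z₂`-instance if it has the form `ABA` with `A, B` nonempty. -/
def Z2Instance {α : Type*} (W : List α) : Prop :=
  ∃ A B : List α, A ≠ [] ∧ B ≠ [] ∧ W = A ++ B ++ A

/-- `instProb2 q n` is the probability that a uniformly random word of length `n`
over a `q`-letter alphabet is a `Z₂`-instance. -/
noncomputable def instProb2 (q n : ℕ) : ℝ :=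
  (Nat.card {W : List (Fin q) // W.length = n ∧ Z2Instance W} : ℝ) / (q : ℝ) ^ n

/-- The finite set of words of length `n`. -/
noncomputable def wordsOfLength (α : Type*) [Finite α] (n : ℕ) : Finset (List α) :=
  (List.finite_length_eq α n).toFinset

@[simp]
lemma mem_wordsOfLength {α : Type*} [Finite α] {n : ℕ} {W : List α} :
    W ∈ wordsOfLength α n ↔ W.length = n := by
  simp [wordsOfLength]

lemma card_wordsOfLength (α : Type*) [Fintype α] (n : ℕ) :
    (wordsOfLength α n).card = Fintype.card α ^ n := by
  rw [← card_vector (α := α) n, ← Nat.card_eq_fintype_card]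
  exact (Nat.subtype_card _ fun W => mem_wordsOfLength).symm

open scoped Classical in
/-- The finite set of `Z₂`-instances of length `n`. -/
noncomputable def z2Words (α : Type*) [Finite α] (n : ℕ) : Finset (List α) :=
  (wordsOfLength α n).filter Z2Instance

@[simp]
lemma mem_z2Words {α : Type*} [Finite α] {n : ℕ} {W : List α} :
    W ∈ z2Words α n ↔ W.length = n ∧ Z2Instance W := by
  simp [z2Words]

lemma instProb2_eq_card_div (q n : ℕ) :
    instProb2 q n = ((z2Words (Fin q) n).card : ℝ) / (q : ℝ) ^ n := by
  rw [instProb2, Nat.subtype_card (z2Words (Fin q) n) fun W => mem_z2Words]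

/-- Inserting a letter in the middle of a `Z₂`-instance yields a `Z₂`-instance. -/
lemma Z2Instance.insert_middle {α : Type*} {W : List α} (hW : Z2Instance W) (c : α) :
    Z2Instance (W.take (W.length / 2) ++ c :: W.drop (W.length / 2)) := by
  obtain ⟨A, B, hA, hB, rfl⟩ := hW
  obtain ⟨j, hj⟩ : ∃ j, (A ++ B ++ A).length / 2 = A.length + j :=
    Nat.exists_eq_add_of_le (by simp only [List.length_append]; omega)
  have hjB : j ≤ B.length := by simp only [List.length_append] at hj; omega
  refine ⟨A, B.take j ++ c :: B.drop j, hA, by simp, ?_⟩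
  rw [hj, List.append_assoc, List.take_length_add_append, List.drop_length_add_append,
    List.take_append_of_le_length hjB, List.drop_append_of_le_length hjB]
  simp

lemma card_mul_card_z2Words_le (α : Type*) [Fintype α] (n : ℕ) :
    (z2Words α n).card * Fintype.card α ≤ (z2Words α (n + 1)).card := by
  rw [← Finset.card_univ, ← Finset.card_product]
  refine Finset.card_le_card_of_injOn
    (fun p => p.1.take (n / 2) ++ p.2 :: p.1.drop (n / 2)) ?_ ?_
  · rintro ⟨W, c⟩ h
    obtain ⟨hn, hW⟩ : W.length = n ∧ Z2Instance W := by simpa using h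
    subst hn
    simp only [Finset.mem_coe, mem_z2Words]
    refine ⟨?_, hW.insert_middle c⟩
    simp only [List.length_append, List.length_take, List.length_cons, List.length_drop]
    omega
  · rintro ⟨W, c⟩ h ⟨V, d⟩ h' he
    obtain ⟨hn, -⟩ : W.length = n ∧ Z2Instance W := by simpa using h
    obtain ⟨hn', -⟩ : V.length = n ∧ Z2Instance V := by simpa using h'
    obtain ⟨h₁, h₂⟩ := List.append_inj he (by simp [hn, hn'])
    obtain ⟨h₃, h₄⟩ := List.cons.inj h₂
    rw [Prod.mk.injEq, ← List.take_append_drop (n / 2) W, ← List.take_append_drop (n / 2) V]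
    exact ⟨congrArg₂ _ h₁ h₄, h₃⟩

lemma pow_four_lt_card_z2Words_five (α : Type*) [Fintype α] [Nontrivial α] :
    Fintype.card α ^ 4 < (z2Words α 5).card := by
  classical
  obtain ⟨a, b, hab⟩ := exists_pair_ne α
  let S : Finset (List α) := (Finset.univ ×ˢ wordsOfLength α 3).image
    fun p : α × List α => [p.1] ++ p.2 ++ [p.1]
  have hS : S.card = Fintype.card α ^ 4 := by
    rw [Finset.card_image_of_injective, Finset.card_product, card_wordsOfLength,
      Finset.card_univ]
    · ring
    · rintro ⟨x, B⟩ ⟨y, C⟩ h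
      simp only [List.cons_append, List.nil_append, List.cons.injEq] at h
      obtain ⟨rfl, h⟩ := h
      simpa using h
  rw [← hS]
  refine Finset.card_lt_card (Finset.ssubset_iff_of_subset ?_ |>.2
    ⟨[a, b, a, a, b], ?_, ?_⟩)
  · intro W hW
    obtain ⟨⟨x, B⟩, hB, rfl⟩ := Finset.mem_image.1 hW
    have hB : B.length = 3 := by simpa using hB
    exact mem_z2Words.2 ⟨by simp [hB], [x], B, by simp, by rintro rfl; simp at hB, rfl⟩
  · exact mem_z2Words.2 ⟨rfl, [a, b], [a], by simp, by simp, rfl⟩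
  · intro h
    obtain ⟨⟨x, B⟩, -, h⟩ := Finset.mem_image.1 h
    have h₁ : x = a := (List.cons.inj h).1
    have h₂ := (List.append_inj' (t₁ := [x]) (s₂ := [a, b, a, a]) (t₂ := [b]) h rfl).2
    rw [List.singleton_inj] at h₂
    exact hab (h₁.symm.trans h₂)

open scoped Classical in
/-- Every `Z₂`-instance has a border that is a single letter, a pair of distinct letters, or a
word of length at least three. -/
lemma z2Words_subset (α : Type*) [Fintype α] (n : ℕ) :
    z2Words α n ⊆
      ((Finset.univ ×ˢ wordsOfLength α (n - 2)).image
        fun p : α × List α => [p.1] ++ p.2 ++ [p.1]) ∪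
      ((Finset.univ.offDiag ×ˢ wordsOfLength α (n - 4)).image
        fun p : (α × α) × List α => [p.1.1, p.1.2] ++ p.2 ++ [p.1.1, p.1.2]) ∪
      (Finset.Ico 3 (n / 2 + 1)).biUnion fun k =>
        (wordsOfLength α k ×ˢ wordsOfLength α (n - 2 * k)).image
          fun p : List α × List α => p.1 ++ p.2 ++ p.1 := by
  intro W hW
  obtain ⟨hn, A, B, hA, hB, rfl⟩ := mem_z2Words.1 hW
  simp only [List.length_append] at hn
  simp only [Finset.mem_union, Finset.mem_biUnion, Finset.mem_image, Finset.mem_product,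
    mem_wordsOfLength, Finset.mem_univ, true_and, Finset.mem_offDiag, Finset.mem_Ico]
  match A, hA with
  | [a], _ =>
    simp only [List.length_singleton] at hn
    exact .inl (.inl ⟨(a, B), by simp only; omega, rfl⟩)
  | [a, b], _ =>
    simp only [List.length_cons, List.length_nil] at hn
    by_cases hab : a = b
    · subst hab
      exact .inl (.inl ⟨(a, [a] ++ B ++ [a]), by simp; omega, by simp⟩)
    · exact .inl (.inr ⟨((a, b), B), ⟨hab, by simp only; omega⟩, rfl⟩)
  | a :: b :: c :: A', _ =>
    refine .inr ⟨(a :: b :: c :: A').length, ?_, (_, B), ⟨rfl, ?_⟩, rfl⟩ <;>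
    · simp only [List.length_cons] at hn ⊢
      omega

lemma card_z2Words_le (α : Type*) [Fintype α] (n : ℕ) :
    (z2Words α n).card ≤
      Fintype.card α * Fintype.card α ^ (n - 2) +
      (Fintype.card α * Fintype.card α - Fintype.card α) * Fintype.card α ^ (n - 4) +
      ∑ k ∈ Finset.Ico 3 (n / 2 + 1), Fintype.card α ^ k * Fintype.card α ^ (n - 2 * k) := by
  classical
  refine (Finset.card_le_card (z2Words_subset α n)).trans <| (Finset.card_union_le _ _).trans <|
    add_le_add ((Finset.card_union_le _ _).trans <| add_le_add ?_ ?_) <|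
      Finset.card_biUnion_le.trans <| Finset.sum_le_sum fun k _ => ?_
  all_goals
    refine Finset.card_image_le.trans_eq ?_
    simp only [Finset.card_product, Finset.offDiag_card, card_wordsOfLength, Finset.card_univ]

lemma instProb2_monotone {q : ℕ} (hq : 0 < q) : Monotone (instProb2 q) := by
  refine monotone_nat_of_le_succ fun n => ?_
  have hq' : (0 : ℝ) < q := by exact_mod_cast hq
  have h : ((z2Words (Fin q) n).card : ℝ) * q ≤ (z2Words (Fin q) (n + 1)).card := by
    exact_mod_cast Fintype.card_fin q ▸ card_mul_card_z2Words_le (Fin q) n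
  rw [instProb2_eq_card_div, instProb2_eq_card_div, div_le_div_iff₀ (by positivity) (by positivity),
    pow_succ']
  calc _ = ((z2Words (Fin q) n).card * q : ℝ) * q ^ n := by ring
    _ ≤ _ := by gcongr

lemma one_div_lt_instProb2_five {q : ℕ} (hq : 2 ≤ q) : 1 / (q : ℝ) < instProb2 q 5 := by
  have : Nontrivial (Fin q) := Fin.nontrivial_iff_two_le.2 hq
  have hq' : (0 : ℝ) < q := by positivity
  have h : (q : ℝ) ^ 4 < (z2Words (Fin q) 5).card := by
    exact_mod_cast Fintype.card_fin q ▸ pow_four_lt_card_z2Words_five (Fin q)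
  rw [instProb2_eq_card_div, div_lt_div_iff₀ hq' (by positivity)]
  calc 1 * (q : ℝ) ^ 5 = q ^ 4 * q := by ring
    _ < _ := by gcongr

lemma instProb2_le {q n : ℕ} (hq : 2 ≤ q) (hn : 4 ≤ n) :
    instProb2 q n ≤ 1 / ((q : ℝ) - 1) - 1 / (q : ℝ) ^ 3 := by
  have hq₂ : (2 : ℝ) ≤ q := by exact_mod_cast hq
  have hq₀ : (0 : ℝ) < q := by linarith
  have hq₁ : (0 : ℝ) < (q : ℝ) - 1 := by linarith
  have hcard : ((z2Words (Fin q) n).card : ℝ) ≤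
      q * q ^ (n - 2) + (q * q - q) * q ^ (n - 4) +
        ∑ k ∈ Finset.Ico 3 (n / 2 + 1), (q : ℝ) ^ k * q ^ (n - 2 * k) := by
    have h := card_z2Words_le (Fin q) n
    rw [Fintype.card_fin] at h
    have h' := (Nat.cast_le (α := ℝ)).2 h
    push_cast [Nat.cast_sub (Nat.le_mul_self q)] at h'
    exact h'
  have hsum : ∑ k ∈ Finset.Ico 3 (n / 2 + 1), (q : ℝ) ^ k * q ^ (n - 2 * k) =
      (∑ k ∈ Finset.Ico 3 (n / 2 + 1), ((q : ℝ)⁻¹) ^ k) * q ^ n := by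
    rw [Finset.sum_mul]
    refine Finset.sum_congr rfl fun k hk => ?_
    have hk' : n = k + (k + (n - 2 * k)) := by
      have := Finset.mem_Ico.1 hk
      omega
    conv_rhs => rw [hk', pow_add, ← mul_assoc, ← mul_pow, inv_mul_cancel₀ hq₀.ne', one_pow, one_mul]
    rw [pow_add]
  have hgeom : ∑ k ∈ Finset.Ico 3 (n / 2 + 1), ((q : ℝ)⁻¹) ^ k ≤
      ((q : ℝ)⁻¹) ^ 3 / (1 - (q : ℝ)⁻¹) :=
    geom_sum_Ico_le_of_lt_one (by positivity) (inv_lt_one_of_one_lt₀ (by linarith))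
  obtain ⟨m, rfl⟩ := Nat.exists_eq_add_of_le hn
  have htotal : (q : ℝ) * q ^ (4 + m - 2) + (q * q - q) * q ^ (4 + m - 4) +
      ((q : ℝ)⁻¹) ^ 3 / (1 - (q : ℝ)⁻¹) * q ^ (4 + m) =
      (1 / ((q : ℝ) - 1) - 1 / (q : ℝ) ^ 3) * q ^ (4 + m) := by
    rw [show 4 + m - 2 = 2 + m by omega, show 4 + m - 4 = m by omega, pow_add, pow_add]
    have : 1 - (q : ℝ)⁻¹ = (q - 1) / q := by field_simp
    rw [this]
    field_simp
    ring
  rw [instProb2_eq_card_div, div_le_iff₀ (by positivity), ← htotal]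
  rw [hsum] at hcard
  refine hcard.trans ?_
  gcongr

/-- For `q ≥ 2`, `instProb2 q n` converges to a limit `I` with `1/q < I < 1/(q−1)`. -/
theorem instProb2_limit_bounds (q : ℕ) (hq : 2 ≤ q) :
    ∃ I : ℝ, Filter.Tendsto (fun n => instProb2 q n) Filter.atTop (nhds I) ∧
      1 / (q : ℝ) < I ∧ I < 1 / ((q : ℝ) - 1) := by
  have hmono := instProb2_monotone (show 0 < q by omega)
  have hbound : ∀ n, instProb2 q n ≤ 1 / ((q : ℝ) - 1) - 1 / (q : ℝ) ^ 3 := fun n =>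
    (hmono (Nat.le_add_right n 4)).trans (instProb2_le hq (Nat.le_add_left 4 n))
  have hbdd : BddAbove (Set.range (instProb2 q)) := ⟨_, Set.forall_mem_range.2 hbound⟩
  refine ⟨⨆ n, instProb2 q n, tendsto_atTop_ciSup hmono hbdd,
    (one_div_lt_instProb2_five hq).trans_le (le_ciSup hbdd 5),
    (ciSup_le hbound).trans_lt (sub_lt_self _ ?_)⟩
  positivity
end

section
/- For every integer q ≥ 2, the sequence II_n(Z_2, q) converges to a limit I(Z_2, q) satisfying I(Z_2, q) > 1/(q−1) − q^{−3} / ((1 − q^{−1})(1 − q^{−3})). -/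
/-- `A` is a nonempty prefix and suffix of `W`. -/
def IsBorder {α : Type*} (A W : List α) : Prop :=
  A ≠ [] ∧ A <+: W ∧ A <:+ W

/-- A nonempty word is unbordered if it is its own only border. -/
def Unbordered {α : Type*} (W : List α) : Prop :=
  W ≠ [] ∧ ∀ A, IsBorder A W → A = W

section Borders

variable {α : Type*} {A B W : List α}

theorem IsBorder.trans (h : IsBorder A B) (h' : IsBorder B W) : IsBorder A W :=
  ⟨h.1, h.2.1.trans h'.2.1, h.2.2.trans h'.2.2⟩

theorem IsBorder.length_le (h : IsBorder A W) : A.length ≤ W.length :=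
  h.2.1.length_le

theorem IsBorder.exists_unbordered (h : IsBorder A W) :
    ∃ C, Unbordered C ∧ IsBorder C W ∧ C.length ≤ A.length := by
  induction hn : A.length using Nat.strong_induction_on generalizing A with
  | _ n ih =>
    by_cases hA : Unbordered A
    · exact ⟨A, hA, h, hn.le⟩
    · have : ∃ B, IsBorder B A ∧ B ≠ A := by
        by_contra! hB
        exact hA ⟨h.1, hB⟩
      obtain ⟨B, hB, hne⟩ := this
      have hlt : B.length < A.length :=
        lt_of_le_of_ne hB.length_le fun he => hne (hB.2.1.eq_of_length he)
      obtain ⟨C, hC, hCW, hl⟩ := ih _ (hn ▸ hlt) (hB.trans h) rfl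
      exact ⟨C, hC, hCW, by omega⟩

theorem Unbordered.two_mul_length_le (hA : Unbordered A) (h : IsBorder A W) (hne : A ≠ W) :
    2 * A.length ≤ W.length := by
  by_contra! hlt
  obtain ⟨-, ⟨X, hX⟩, ⟨Y, hY⟩⟩ := h
  have hlY : Y.length + A.length = W.length := by rw [← hY, List.length_append]
  have hYA : Y <+: A :=
    List.prefix_of_prefix_length_le ⟨A, hY⟩ ⟨X, hX⟩ (by omega)
  obtain ⟨C, rfl⟩ := hYA
  have hC : Y ++ C = C ++ X := by
    have := hY.trans hX.symm
    rw [List.append_assoc] at this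
    exact List.append_cancel_left this
  have hCY : C = Y ++ C := by
    refine hA.2 C ⟨?_, ⟨X, hC.symm⟩, ⟨Y, rfl⟩⟩
    rintro rfl
    simp at hlt hlY
    omega
  have hY0 : Y = [] := by
    have := congrArg List.length hCY
    simpa using this
  subst hY0
  exact hne hY

theorem Unbordered.eq_of_isBorder (hA : Unbordered A) (hB : Unbordered B)
    (hAW : IsBorder A W) (hBW : IsBorder B W) : A = B := by
  rcases le_total A.length B.length with h | h
  · exact hB.2 A ⟨hA.1, List.prefix_of_prefix_length_le hAW.2.1 hBW.2.1 h,
      List.suffix_of_suffix_length_le hAW.2.2 hBW.2.2 h⟩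
  · exact (hA.2 B ⟨hB.1, List.prefix_of_prefix_length_le hBW.2.1 hAW.2.1 h,
      List.suffix_of_suffix_length_le hBW.2.2 hAW.2.2 h⟩).symm

theorem isBorder_append_append (hA : A ≠ []) : IsBorder A (A ++ B ++ A) :=
  ⟨hA, by simp [List.append_assoc], List.suffix_append _ _⟩

theorem IsBorder.exists_eq_append (h : IsBorder A W) (hl : 2 * A.length ≤ W.length) :
    ∃ B, W = A ++ B ++ A := by
  obtain ⟨-, ⟨X, hX⟩, ⟨Y, hY⟩⟩ := h
  have hlY : Y.length + A.length = W.length := by rw [← hY, List.length_append]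
  obtain ⟨B, rfl⟩ : A <+: Y :=
    List.prefix_of_prefix_length_le ⟨X, hX⟩ ⟨A, hY⟩ (by omega)
  exact ⟨B, hY.symm⟩

end Borders

section Counting

variable {α : Type*}

/-- The unbordered words of length `k`. -/
def unborderedWords (α : Type*) (k : ℕ) : Set (List α) :=
  {W | W.length = k ∧ Unbordered W}

/-- The words of length `n` with an unbordered border of length `k`. -/
def wordsWithBorder (α : Type*) (n k : ℕ) : Set (List α) :=
  {W | W.length = n ∧ ∃ A ∈ unborderedWords α k, IsBorder A W}

theorem unborderedWords_zero : unborderedWords α 0 = ∅ := by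
  ext W
  simp only [unborderedWords, Set.mem_ofPred_eq, Set.mem_empty_iff_false, iff_false, not_and]
  intro h hW
  exact hW.1 (List.length_eq_zero_iff.1 h)

theorem setOf_z2Instance_eq (n : ℕ) :
    {W : List α | W.length = n ∧ Z2Instance W} =
      ⋃ k ∈ Finset.range ((n + 1) / 2), wordsWithBorder α n k := by
  ext W
  simp only [Set.mem_ofPred_eq, Set.mem_iUnion, Finset.mem_range, wordsWithBorder, unborderedWords,
    exists_prop]
  constructor
  · rintro ⟨hn, A, B, hA, hB, rfl⟩
    obtain ⟨C, hC, hCW, hl⟩ := (isBorder_append_append (B := B) hA).exists_unbordered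
    refine ⟨C.length, ?_, hn, C, ⟨rfl, hC⟩, hCW⟩
    have := List.length_pos_iff.2 hB
    simp only [List.length_append] at hn
    omega
  · rintro ⟨k, hk, hn, A, ⟨rfl, hA⟩, hAW⟩
    obtain ⟨B, rfl⟩ := hAW.exists_eq_append (by omega)
    refine ⟨hn, A, B, hA.1, ?_, rfl⟩
    rintro rfl
    simp only [List.length_append, List.length_nil] at hn
    omega

theorem setOf_length_diff_unborderedWords (n : ℕ) (hn0 : n ≠ 0) :
    {W : List α | W.length = n} \ unborderedWords α n =
      ⋃ k ∈ Finset.range (n / 2 + 1), wordsWithBorder α n k := by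
  ext W
  simp only [Set.mem_ofPred_eq, Set.mem_iUnion, Finset.mem_range, wordsWithBorder, unborderedWords,
    exists_prop, Set.mem_sdiff]
  constructor
  · rintro ⟨hn, hW⟩
    have hW0 : W ≠ [] := by
      rintro rfl
      exact hn0 hn.symm
    obtain ⟨C, hC, hCW, -⟩ :=
      (show IsBorder W W from ⟨hW0, List.prefix_rfl, List.suffix_rfl⟩).exists_unbordered
    have hne : C ≠ W := by
      rintro rfl
      exact hW ⟨hn, hC⟩
    have := hC.two_mul_length_le hCW hne
    exact ⟨C.length, by omega, hn, C, ⟨rfl, hC⟩, hCW⟩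
  · rintro ⟨k, hk, hn, A, ⟨rfl, hA⟩, hAW⟩
    refine ⟨hn, fun hW => ?_⟩
    have := hW.2.2 A hAW
    subst this
    omega

variable [Fintype α]

theorem ncard_setOf_length_eq (n : ℕ) :
    {W : List α | W.length = n}.ncard = Fintype.card α ^ n := by
  rw [← card_vector (α := α) n, ← Nat.card_eq_fintype_card, ← Nat.card_coe_set_eq]
  rfl

theorem finite_wordsWithBorder (n k : ℕ) : (wordsWithBorder α n k).Finite :=
  (List.finite_length_eq α n).subset fun _ h => h.1

theorem ncard_wordsWithBorder {n k : ℕ} (h : 2 * k ≤ n) :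
    (wordsWithBorder α n k).ncard =
      (unborderedWords α k).ncard * Fintype.card α ^ (n - 2 * k) := by
  have himg : wordsWithBorder α n k = (fun p : List α × List α => p.1 ++ p.2 ++ p.1) ''
      (unborderedWords α k ×ˢ {B | B.length = n - 2 * k}) := by
    ext W
    constructor
    · rintro ⟨hn, A, ⟨rfl, hA⟩, hAW⟩
      obtain ⟨B, rfl⟩ := hAW.exists_eq_append (by omega)
      simp only [List.length_append] at hn
      exact ⟨(A, B), ⟨⟨rfl, hA⟩, show B.length = _ by omega⟩, rfl⟩
    · rintro ⟨⟨A, B⟩, ⟨⟨rfl, hA⟩, hB⟩, rfl⟩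
      refine ⟨?_, A, ⟨rfl, hA⟩, isBorder_append_append hA.1⟩
      change 2 * A.length ≤ n at h
      change B.length = n - 2 * A.length at hB
      simp only [List.length_append]
      omega
  rw [himg, Set.InjOn.ncard_image, Set.ncard_prod, ncard_setOf_length_eq]
  rintro ⟨A, B⟩ ⟨⟨hA, -⟩, -⟩ ⟨A', B'⟩ ⟨⟨hA', -⟩, -⟩ heq
  simp only [List.append_assoc] at heq
  obtain ⟨rfl, h2⟩ := List.append_inj heq (hA.trans hA'.symm)
  rw [List.append_cancel_right h2]

theorem ncard_biUnion_wordsWithBorder {n m : ℕ} (h : ∀ k < m, 2 * k ≤ n) :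
    (⋃ k ∈ Finset.range m, wordsWithBorder α n k).ncard =
      ∑ k ∈ Finset.range m, (unborderedWords α k).ncard * Fintype.card α ^ (n - 2 * k) := by
  induction m with
  | zero => simp
  | succ m ih =>
    rw [Finset.sum_range_succ, ← ih fun k hk => h k (by omega),
      ← ncard_wordsWithBorder (h m (by omega)), Finset.range_add_one, Finset.set_biUnion_insert,
      Set.union_comm, Set.ncard_union_eq _ _ (finite_wordsWithBorder n m)]
    · rw [Set.disjoint_left]
      rintro W hW ⟨-, A, ⟨hl, hA⟩, hAW⟩
      simp only [Set.mem_iUnion, Finset.mem_range] at hW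
      obtain ⟨k, hk, -, B, ⟨hl', hB⟩, hBW⟩ := hW
      have := hA.eq_of_isBorder hB hAW hBW
      subst this
      omega
    · exact (Finset.range m).finite_toSet.biUnion fun k _ => finite_wordsWithBorder n k

end Counting

/-- The number of unbordered words of length `k` over `q` letters, divided by `q ^ (2 * k)`. -/
noncomputable def unborderedWeight (q k : ℕ) : ℝ :=
  (unborderedWords (Fin q) k).ncard * ((q : ℝ)⁻¹ ^ k * (q : ℝ)⁻¹ ^ k)

theorem sum_ncard_div {q n m : ℕ} (hq : q ≠ 0) (h : ∀ k < m, 2 * k ≤ n) :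
    ((∑ k ∈ Finset.range m, (unborderedWords (Fin q) k).ncard * q ^ (n - 2 * k) : ℕ) : ℝ) / q ^ n =
      ∑ k ∈ Finset.range m, unborderedWeight q k := by
  have hq' : (q : ℝ) ≠ 0 := by exact_mod_cast hq
  rw [Nat.cast_sum, Finset.sum_div]
  refine Finset.sum_congr rfl fun k hk => ?_
  obtain ⟨d, rfl⟩ := Nat.exists_eq_add_of_le (h k (Finset.mem_range.1 hk))
  rw [unborderedWeight, Nat.add_sub_cancel_left]
  push_cast
  rw [pow_add, two_mul, pow_add, inv_pow]
  field_simp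

theorem instProb2_eq_sum {q : ℕ} (hq : q ≠ 0) (n : ℕ) :
    instProb2 q n = ∑ k ∈ Finset.range ((n + 1) / 2), unborderedWeight q k := by
  have h : ∀ k < (n + 1) / 2, 2 * k ≤ n := fun k hk => by omega
  have hcard : Nat.card {W : List (Fin q) // W.length = n ∧ Z2Instance W} =
      {W : List (Fin q) | W.length = n ∧ Z2Instance W}.ncard :=
    Nat.card_coe_set_eq {W : List (Fin q) | W.length = n ∧ Z2Instance W}
  rw [instProb2, hcard, setOf_z2Instance_eq, ncard_biUnion_wordsWithBorder h, Fintype.card_fin,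
    sum_ncard_div hq h]

theorem unborderedWeight_zero (q : ℕ) : unborderedWeight q 0 = 0 := by
  simp [unborderedWeight, unborderedWords_zero]

theorem unborderedWeight_nonneg (q k : ℕ) : 0 ≤ unborderedWeight q k := by
  unfold unborderedWeight
  positivity

theorem unborderedWeight_eq {q n : ℕ} (hq : q ≠ 0) (hn : n ≠ 0) :
    unborderedWeight q n =
      (q : ℝ)⁻¹ ^ n * (1 - ∑ k ∈ Finset.range (n / 2 + 1), unborderedWeight q k) := by
  have h : ∀ k < n / 2 + 1, 2 * k ≤ n := fun k hk => by omega
  have hq' : (q : ℝ) ≠ 0 := by exact_mod_cast hq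
  have hsub : unborderedWords (Fin q) n ⊆ {W | W.length = n} := fun _ hW => hW.1
  have hadd := Set.ncard_sdiff_add_ncard_of_subset hsub (List.finite_length_eq _ n)
  rw [setOf_length_diff_unborderedWords n hn, ncard_biUnion_wordsWithBorder h,
    ncard_setOf_length_eq, Fintype.card_fin] at hadd
  rw [← sum_ncard_div hq h, unborderedWeight]
  have hadd' := congrArg (Nat.cast : ℕ → ℝ) hadd
  rw [Nat.cast_add, Nat.cast_pow] at hadd'
  rw [eq_sub_of_add_eq hadd', inv_pow]
  field_simp
  ring

theorem lt_tsum_of_recurrence {x : ℝ} {a : ℕ → ℝ} (hx0 : 0 < x) (hx1 : x < 1) (ha0 : a 0 = 0)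
    (hnn : ∀ n, 0 ≤ a n)
    (hrec : ∀ n, n ≠ 0 → a n = x ^ n * (1 - ∑ k ∈ Finset.range (n / 2 + 1), a k)) :
    Summable a ∧ x / (1 - x) - x ^ 3 / ((1 - x) * (1 - x ^ 3)) < ∑' n, a n := by
  have hle : ∀ n, a n ≤ x ^ n := fun n => by
    rcases eq_or_ne n 0 with rfl | hn
    · simp [ha0]
    · rw [hrec n hn]
      have := Finset.sum_nonneg fun k (_ : k ∈ Finset.range (n / 2 + 1)) => hnn k
      exact mul_le_of_le_one_right (by positivity) (by linarith)
  have hgeom := summable_geometric_of_lt_one hx0.le hx1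
  have hs : Summable a := hgeom.of_nonneg_of_le hnn hle
  refine ⟨hs, ?_⟩
  have hx3 : x ^ 3 < 1 := pow_lt_one₀ hx0.le hx1 (by norm_num)
  have hy : x ^ 2 < 1 := pow_lt_one₀ hx0.le hx1 (by norm_num)
  have hlt : a 2 < x ^ 2 := by
    have h1 := hrec 1 one_ne_zero
    have h2 := hrec 2 two_ne_zero
    norm_num [Finset.sum_range_succ, ha0] at h1 h2
    rw [h2, h1]
    nlinarith [pow_pos hx0 2]
  set w : ℕ → ℝ := fun m => (x ^ 2) ^ m * (1 - ∑ k ∈ Finset.range (m + 1), a k) with hw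
  have heven : ∀ m, a (2 * (m + 1)) = w (m + 1) := fun m => by
    rw [hrec _ (by omega), hw, Nat.mul_div_cancel_left _ two_pos, pow_mul]
  have hodd : ∀ m, a (2 * m + 1) = x * w m := fun m => by
    rw [hrec _ (by omega), hw, show (2 * m + 1) / 2 = m by omega, pow_succ, pow_mul]
    ring
  have hw0 : w 0 = 1 := by simp [hw, ha0]
  have hsw : Summable w := by
    rw [← summable_nat_add_iff 1]
    refine Summable.congr (f := fun m => a (2 * (m + 1))) ?_ heven
    exact hs.comp_injective fun m n h => by simpa using h
  have hse : Summable fun m => a (2 * m) := hs.comp_injective fun m n h => by simpa using h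
  have hso : Summable fun m => a (2 * m + 1) := hs.comp_injective fun m n h => by simpa using h
  have hI : ∑' n, a n = (1 + x) * ∑' m, w m - 1 := by
    rw [← tsum_even_add_odd hse hso, tsum_congr hodd, tsum_mul_left, hse.tsum_eq_zero_add,
      tsum_congr heven, hsw.tsum_eq_zero_add, hw0]
    simp only [mul_zero, ha0]
    ring
  have hbnd : ∀ m, (x ^ 2) ^ (m + 1) * a (m + 1) ≤ x ^ 3 * (x ^ 3) ^ m := fun m => by
    calc _ ≤ (x ^ 2) ^ (m + 1) * x ^ (m + 1) := by gcongr; exact hle _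
      _ = _ := by ring
  have hg3 : Summable fun m => x ^ 3 * (x ^ 3) ^ m :=
    (summable_geometric_of_lt_one (by positivity) hx3).mul_left _
  have hsb : Summable fun m => (x ^ 2) ^ (m + 1) * a (m + 1) :=
    hg3.of_nonneg_of_le (fun m => mul_nonneg (by positivity) (hnn _)) hbnd
  have hQ : ∑' m, (x ^ 2) ^ (m + 1) * a (m + 1) < x ^ 3 / (1 - x ^ 3) := by
    calc _ < ∑' m, x ^ 3 * (x ^ 3) ^ m := by
          refine Summable.tsum_lt_tsum (i := 1) hbnd ?_ hsb hg3
          calc (x ^ 2) ^ (1 + 1) * a (1 + 1) < (x ^ 2) ^ (1 + 1) * x ^ 2 := by gcongr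
            _ = _ := by ring
      _ = _ := by
          rw [tsum_mul_left, tsum_geometric_of_lt_one (by positivity) hx3, div_eq_mul_inv]
  have hP : (1 - x ^ 2) * ∑' m, w m = 1 - ∑' m, (x ^ 2) ^ (m + 1) * a (m + 1) := by
    have hstep : ∀ m, w (m + 1) = x ^ 2 * w m - (x ^ 2) ^ (m + 1) * a (m + 1) := fun m => by
      simp only [hw]
      rw [Finset.sum_range_succ _ (m + 1)]
      ring
    have h := hsw.tsum_eq_zero_add
    rw [tsum_congr hstep, (hsw.mul_left _).tsum_sub hsb, tsum_mul_left, hw0] at h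
    linarith
  have h1x : 0 < 1 - x := by linarith
  have h1x3 : 0 < 1 - x ^ 3 := by linarith
  have hfin : (1 - x) * (∑' n, a n) > x - x ^ 3 / (1 - x ^ 3) := by
    rw [hI]
    linear_combination hQ - hP
  rw [← div_div, div_right_comm, ← sub_div, div_lt_iff₀ h1x]
  linarith

/-- For `q ≥ 2`, `instProb2 q n` converges to a limit `I` with
`I > 1/(q−1) − q^{−3} / ((1 − q^{−1})(1 − q^{−3}))`. -/
theorem instProb2_limit_lower (q : ℕ) (hq : 2 ≤ q) :
    ∃ I : ℝ, Filter.Tendsto (fun n => instProb2 q n) Filter.atTop (nhds I) ∧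
      1 / ((q : ℝ) - 1) -
        (q : ℝ) ^ (-3 : ℤ) / ((1 - (q : ℝ) ^ (-1 : ℤ)) * (1 - (q : ℝ) ^ (-3 : ℤ))) < I := by
  have hq0 : q ≠ 0 := by omega
  have hq2 : (2 : ℝ) ≤ q := by exact_mod_cast hq
  have hq' : (0 : ℝ) < q := by linarith
  obtain ⟨hs, hlt⟩ := lt_tsum_of_recurrence (x := (q : ℝ)⁻¹) (a := unborderedWeight q)
    (by positivity) (inv_lt_one_of_one_lt₀ (by linarith)) (unborderedWeight_zero q)
    (unborderedWeight_nonneg q) fun n hn => unborderedWeight_eq hq0 hn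
  refine ⟨∑' n, unborderedWeight q n, ?_, ?_⟩
  · simp only [instProb2_eq_sum hq0]
    refine hs.hasSum.tendsto_sum_nat.comp (Filter.tendsto_atTop_atTop.2 fun b => ⟨2 * b, ?_⟩)
    intro n hn
    omega
  · have hx : 1 / ((q : ℝ) - 1) = (q : ℝ)⁻¹ / (1 - (q : ℝ)⁻¹) := by
      have : (q : ℝ) - 1 ≠ 0 := by linarith
      field_simp
    have h3 : (q : ℝ) ^ (-3 : ℤ) = (q : ℝ)⁻¹ ^ 3 := by
      rw [zpow_neg, inv_pow]
      norm_cast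
    rw [hx, h3, zpow_neg_one]
    exact hlt
end
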